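/- arXiv:1611.02993 — 2 statements merged into one kernel-verified Lean document; each statement's English description precedes it below -/
import Mathlib

section
/- Let A : D(A) ⊆ H₀ → H₁ be a densely defined closed linear operator between Hilbert spaces with Hilbert space adjoint A* : D(A*) ⊆ H₁ → H₀. If the best Friedrichs/Poincaré constant c := sup{‖x‖_{H₀}/‖Ax‖_{H₁} : 0 ≠ x ∈ D(A) ∩ N(A)^⊥} is finite (equivalently, the corresponding constant c* for A* is finite), then c = c*, i.e., sup{‖x‖_{H₀}/‖Ax‖_{H₁} : 0 ≠ x ∈ D(A) ∩ N(A)^⊥} = sup{‖y‖_{H₁}/‖A*y‖_{H₀} : 0 ≠ y ∈ D(A*) ∩ N(A*)^⊥}. -/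
open Submodule LinearPMap RealInnerProductSpace

noncomputable section

/-- The range of a partially defined linear operator, as a submodule. -/
def pRan {E F : Type*} [AddCommGroup E] [Module ℝ E] [AddCommGroup F] [Module ℝ F]
    (A : E →ₗ.[ℝ] F) : Submodule ℝ F :=
  LinearMap.range A.toFun

/-- The kernel of a partially defined linear operator, as a submodule of the ambient space. -/
def pKer {E F : Type*} [AddCommGroup E] [Module ℝ E] [AddCommGroup F] [Module ℝ F]
    (A : E →ₗ.[ℝ] F) : Submodule ℝ E :=
  (LinearMap.ker A.toFun).map A.domain.subtype

variable {H₀ H₁ : Type*}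
  [NormedAddCommGroup H₀] [InnerProductSpace ℝ H₀] [CompleteSpace H₀]
  [NormedAddCommGroup H₁] [InnerProductSpace ℝ H₁] [CompleteSpace H₁]

namespace LinearPMap

theorem mem_pKer_iff {E F : Type*} [AddCommGroup E] [Module ℝ E] [AddCommGroup F] [Module ℝ F]
    {A : E →ₗ.[ℝ] F} {x : E} : x ∈ pKer A ↔ (x, (0 : F)) ∈ A.graph := by
  simp only [pKer, Submodule.mem_map, LinearMap.mem_ker, mem_graph_iff]
  exact ⟨fun ⟨y, h0, hy⟩ => ⟨y, hy, h0⟩, fun ⟨y, hy, h0⟩ => ⟨y, h0, hy⟩⟩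

section InnerProductSpace

variable {E F : Type*}
  [NormedAddCommGroup E] [InnerProductSpace ℝ E]
  [NormedAddCommGroup F] [InnerProductSpace ℝ F]
  {A : E →ₗ.[ℝ] F}

theorem isClosed_pKer (hA : A.IsClosed) : _root_.IsClosed (pKer A : Set E) := by
  have h : (pKer A : Set E) = (fun x : E => (x, (0 : F))) ⁻¹' (A.graph : Set (E × F)) := by
    ext x
    exact mem_pKer_iff
  rw [h]
  exact IsClosed.preimage (by fun_prop) hA

/-- The Friedrichs/Poincaré inequality with constant `C` for a partially defined operator. -/
def PoincareBound (A : E →ₗ.[ℝ] F) (C : ℝ) : Prop :=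
  ∀ x : A.domain, (x : E) ∈ (pKer A)ᗮ → ‖(x : E)‖ ≤ C * ‖A x‖

theorem mem_upperBounds_iff_poincareBound (A : E →ₗ.[ℝ] F) {C : ℝ} (hC : 0 ≤ C) :
    C ∈ upperBounds {r : ℝ | ∃ x : A.domain,
        (x : E) ∈ (pKer A)ᗮ ∧ (x : E) ≠ 0 ∧ r = ‖(x : E)‖ / ‖A x‖} ↔ PoincareBound A C := by
  constructor
  · intro h x hx
    by_cases hx0 : (x : E) = 0
    · rw [hx0, norm_zero]
      positivity
    have hAx : A x ≠ 0 := fun hAx => hx0 <| by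
      have hxk : (x : E) ∈ pKer A := mem_pKer_iff.2 ((mem_graph_iff _).2 ⟨x, rfl, hAx⟩)
      exact inner_self_eq_zero.1 (hx _ hxk)
    exact (div_le_iff₀ (norm_pos_iff.2 hAx)).1 (h ⟨x, hx, hx0, rfl⟩)
  · rintro h _ ⟨x, hx, -, rfl⟩
    exact div_le_of_le_mul₀ (norm_nonneg _) hC (h x hx)

variable [CompleteSpace E]

theorem exists_adjoint_apply_eq (hA : Dense (A.domain : Set E)) {y : F} {w : E}
    (h : ∀ x : A.domain, ⟪w, (x : E)⟫ = ⟪y, A x⟫) :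
    ∃ hy : y ∈ A†.domain, A† ⟨y, hy⟩ = w :=
  ⟨mem_adjoint_domain_of_exists y ⟨w, h⟩, adjoint_apply_eq hA _ h⟩

variable [CompleteSpace F]

theorem mem_graph_of_forall_adjoint (hA : Dense (A.domain : Set E)) (hc : A.IsClosed)
    {x : E} {w : F} (h : ∀ y : A†.domain, ⟪x, A† y⟫ = ⟪w, (y : F)⟫) : (x, w) ∈ A.graph := by
  let G : Submodule ℝ (WithLp 2 (E × F)) :=
    A.graph.comap (WithLp.linearEquiv 2 ℝ (E × F)).toLinearMap
  have hG : _root_.IsClosed (G : Set (WithLp 2 (E × F))) :=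
    IsClosed.preimage (WithLp.prod_continuous_ofLp 2 E F) hc
  have hGG : Gᗮᗮ = G := by
    rw [Submodule.orthogonal_orthogonal_eq_closure, hG.submodule_topologicalClosure_eq]
  have hmem : WithLp.toLp 2 (x, w) ∈ Gᗮᗮ := by
    rw [Submodule.mem_orthogonal]
    intro p hp
    have hp' : ∀ a : A.domain, ⟪-p.fst, (a : E)⟫ = ⟪p.snd, A a⟫ := by
      intro a
      have := (Submodule.mem_orthogonal' G p).1 hp (WithLp.toLp 2 ((a : E), A a)) (A.mem_graph a)
      rw [WithLp.prod_inner_apply] at this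
      change ⟪p.fst, (a : E)⟫ + ⟪p.snd, A a⟫ = 0 at this
      rw [inner_neg_left]
      linarith
    obtain ⟨hy, hw⟩ := exists_adjoint_apply_eq hA hp'
    have hxy := h ⟨p.snd, hy⟩
    rw [hw, inner_neg_right] at hxy
    rw [WithLp.prod_inner_apply]
    change ⟪p.fst, x⟫ + ⟪p.snd, w⟫ = 0
    rw [real_inner_comm, real_inner_comm w]
    dsimp only at hxy
    linarith
  rw [hGG] at hmem
  exact hmem

theorem dense_adjoint_domain (hA : Dense (A.domain : Set E)) (hc : A.IsClosed) :
    Dense (A†.domain : Set F) := by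
  rw [Submodule.dense_iff_topologicalClosure_eq_top, Submodule.topologicalClosure_eq_top_iff,
    Submodule.eq_bot_iff]
  intro z hz
  have h : ((0 : E), z) ∈ A.graph := mem_graph_of_forall_adjoint hA hc <| by
    intro y
    rw [inner_zero_left, (Submodule.mem_orthogonal' _ z).1 hz y y.2]
  exact A.graph_fst_eq_zero_snd h rfl

theorem adjoint_adjoint (hA : Dense (A.domain : Set E)) (hc : A.IsClosed) : A†† = A := by
  have hA' := dense_adjoint_domain hA hc
  refine le_antisymm (le_of_le_graph ?_) ((adjoint_isFormalAdjoint hA).le_adjoint hA')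
  rintro ⟨x, w⟩ hxw
  obtain ⟨u, rfl, rfl⟩ := (mem_graph_iff _).1 hxw
  exact mem_graph_of_forall_adjoint hA hc fun y => (adjoint_isFormalAdjoint hA' u y).symm

theorem orthogonal_pKer_adjoint_le (hA : Dense (A.domain : Set E)) :
    (pKer A†)ᗮ ≤ (pRan A).topologicalClosure := by
  rw [← Submodule.orthogonal_orthogonal_eq_closure]
  refine Submodule.orthogonal_le fun y hy => mem_pKer_iff.2 ?_
  obtain ⟨hy', h0⟩ := exists_adjoint_apply_eq (w := 0) hA (y := y) (A := A) <| by
    intro x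
    rw [inner_zero_left]
    exact ((Submodule.mem_orthogonal' _ y).1 hy _ ⟨x, rfl⟩).symm
  exact (mem_graph_iff _).2 ⟨⟨y, hy'⟩, rfl, h0⟩

theorem PoincareBound.adjoint (hA : Dense (A.domain : Set E)) (hc : A.IsClosed) {C : ℝ}
    (hC : 0 ≤ C) (h : PoincareBound A C) : PoincareBound A† C := by
  have := (isClosed_pKer hc).completeSpace_coe
  intro y hy
  have hran : ∀ z ∈ (pRan A).topologicalClosure, ⟪(y : F), z⟫ ≤ C * ‖A† y‖ * ‖z‖ := by
    intro z hz
    refine closure_minimal (s := (pRan A : Set F))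
      (t := {z | ⟪(y : F), z⟫ ≤ C * ‖A† y‖ * ‖z‖}) ?_
      (isClosed_le (by fun_prop) (by fun_prop)) hz
    rintro _ ⟨x, rfl⟩
    obtain ⟨k, hk, p, hp, hx⟩ := (pKer A).exists_add_mem_mem_orthogonal (x : E)
    obtain ⟨k, hk0, rfl⟩ := hk
    have hpd : p ∈ A.domain := by
      rw [eq_sub_iff_add_eq'.2 hx.symm]
      exact A.domain.sub_mem x.2 k.2
    have hAx : A x = A ⟨p, hpd⟩ := by
      have hx' : x = k + ⟨p, hpd⟩ := Subtype.ext hx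
      rw [hx', map_add, show A k = 0 from hk0, zero_add]
    change ⟪(y : F), A x⟫ ≤ C * ‖A† y‖ * ‖A x‖
    rw [hAx, ← adjoint_isFormalAdjoint hA]
    calc ⟪A† y, p⟫ ≤ ‖A† y‖ * ‖p‖ := real_inner_le_norm _ _
      _ ≤ ‖A† y‖ * (C * ‖A ⟨p, hpd⟩‖) := by gcongr; exact h ⟨p, hpd⟩ hp
      _ = _ := by ring
  have hyy := hran y (orthogonal_pKer_adjoint_le hA hy)
  rw [real_inner_self_eq_norm_mul_norm] at hyy
  rcases (norm_nonneg (y : F)).eq_or_lt with h0 | h0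
  · rw [← h0]
    positivity
  · exact le_of_mul_le_mul_right hyy h0

theorem poincareBound_adjoint_iff (hA : Dense (A.domain : Set E)) (hc : A.IsClosed) {C : ℝ}
    (hC : 0 ≤ C) : PoincareBound A† C ↔ PoincareBound A C := by
  refine ⟨fun h => ?_, PoincareBound.adjoint hA hc hC⟩
  have h' := h.adjoint (dense_adjoint_domain hA hc) (adjoint_isClosed hA) hC
  rwa [adjoint_adjoint hA hc] at h'

end InnerProductSpace

end LinearPMap

theorem Real.sSup_eq_sSup_of_upperBounds_iff {s t : Set ℝ} (hs : ∀ r ∈ s, 0 ≤ r)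
    (ht : ∀ r ∈ t, 0 ≤ r) (h : ∀ C, 0 ≤ C → (C ∈ upperBounds s ↔ C ∈ upperBounds t))
    (hb : BddAbove s ∨ BddAbove t) : sSup s = sSup t := by
  have key : ∀ {u v : Set ℝ}, (∀ C, 0 ≤ C → C ∈ upperBounds u → C ∈ upperBounds v) →
      BddAbove u → BddAbove v := fun huv ⟨C, hC⟩ =>
    ⟨max C 0, huv _ (le_max_right _ _) (upperBounds_mono_mem (le_max_left _ _) hC)⟩
  have hbs : BddAbove s := hb.elim id (key fun C hC => (h C hC).2)
  have hbt : BddAbove t := hb.elim (key fun C hC => (h C hC).1) id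
  have hs0 := Real.sSup_nonneg hs
  have ht0 := Real.sSup_nonneg ht
  exact le_antisymm (Real.sSup_le ((h _ ht0).2 fun _ hr => le_csSup hbt hr) ht0)
    (Real.sSup_le ((h _ hs0).1 fun _ hr => le_csSup hbs hr) hs0)

/-- For a densely defined closed operator `A` with Hilbert space adjoint `A†`:
if the best Friedrichs/Poincaré constant `c = sup ‖x‖/‖Ax‖` over `x ∈ D(A) ∩ N(A)^⊥` is finite
(equivalently the corresponding constant for `A†` is finite), then the two constants coincide. -/
theorem statement2 (A : H₀ →ₗ.[ℝ] H₁) (hdense : Dense (A.domain : Set H₀))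
    (hclosed : A.IsClosed)
    (hfin : BddAbove {r : ℝ | ∃ x : A.domain,
        (x : H₀) ∈ (pKer A)ᗮ ∧ (x : H₀) ≠ 0 ∧ r = ‖(x : H₀)‖ / ‖A x‖} ∨
      BddAbove {r : ℝ | ∃ y : (A†).domain,
        (y : H₁) ∈ (pKer (A†))ᗮ ∧ (y : H₁) ≠ 0 ∧ r = ‖(y : H₁)‖ / ‖A† y‖}) :
    sSup {r : ℝ | ∃ x : A.domain,
        (x : H₀) ∈ (pKer A)ᗮ ∧ (x : H₀) ≠ 0 ∧ r = ‖(x : H₀)‖ / ‖A x‖} =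
      sSup {r : ℝ | ∃ y : (A†).domain,
        (y : H₁) ∈ (pKer (A†))ᗮ ∧ (y : H₁) ≠ 0 ∧ r = ‖(y : H₁)‖ / ‖A† y‖} := by
  refine Real.sSup_eq_sSup_of_upperBounds_iff ?_ ?_ (fun C hC => ?_) hfin
  · rintro _ ⟨x, -, -, rfl⟩
    positivity
  · rintro _ ⟨y, -, -, rfl⟩
    positivity
  · rw [mem_upperBounds_iff_poincareBound A hC, mem_upperBounds_iff_poincareBound A† hC,
      poincareBound_adjoint_iff hdense hclosed hC]
end
end

section
/- In the first order setting, let x ∈ D₂ be the exact solution of A₂x = f, A₁*x = g, πx = k, let x̃ ∈ H₂ be arbitrary, and set e := x − x̃ and e_{A₁} := π_{R(A₁)}e. Then ‖e_{A₁}‖_{H₂} = min over ζ ∈ D(A₁*) of ( c₁‖A₁*ζ − g‖_{H₁} + ‖ζ − x̃‖_{H₂} ), and the minimum is attained at ζ̂ := e_{A₁} + x̃, which belongs to D(A₁*) and satisfies A₁*ζ̂ = g. -/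
open Submodule LinearPMap RealInnerProductSpace

noncomputable section

variable {H₁ H₂ H₃ : Type*}
  [NormedAddCommGroup H₁] [InnerProductSpace ℝ H₁] [CompleteSpace H₁]
  [NormedAddCommGroup H₂] [InnerProductSpace ℝ H₂] [CompleteSpace H₂]
  [NormedAddCommGroup H₃] [InnerProductSpace ℝ H₃] [CompleteSpace H₃]

/-- A vector orthogonal to the range lies in the domain of the adjoint, so subtracting it from an
element of that domain stays in the domain and does not change the value of the adjoint. -/
theorem adjoint_sub_of_mem_orthogonal_pRan {E F : Type*}
    [NormedAddCommGroup E] [InnerProductSpace ℝ E] [CompleteSpace E]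
    [NormedAddCommGroup F] [InnerProductSpace ℝ F]
    {A : E →ₗ.[ℝ] F} (hA : Dense (A.domain : Set E)) {y z : F}
    (hy : y ∈ (A†).domain) (hz : z ∈ (pRan A)ᗮ) :
    ∃ h : y - z ∈ (A†).domain, A† ⟨y - z, h⟩ = A† ⟨y, hy⟩ := by
  have key : ∀ u : A.domain, ⟪A† ⟨y, hy⟩, (u : E)⟫ = ⟪y - z, A u⟫ := fun u => by
    have hzu : ⟪z, A u⟫ = 0 := (mem_orthogonal' _ _).1 hz _ ⟨u, rfl⟩
    rw [inner_sub_left, hzu, sub_zero]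
    exact adjoint_isFormalAdjoint hA ⟨y, hy⟩ u
  exact ⟨mem_adjoint_domain_of_exists _ ⟨_, key⟩, adjoint_apply_eq hA _ key⟩

/-- The range of a densely defined operator is orthogonal to the kernel of its adjoint. -/
theorem pRan_le_orthogonal_pKer_adjoint {E F : Type*}
    [NormedAddCommGroup E] [InnerProductSpace ℝ E] [CompleteSpace E]
    [NormedAddCommGroup F] [InnerProductSpace ℝ F]
    {A : E →ₗ.[ℝ] F} (hA : Dense (A.domain : Set E)) :
    pRan A ≤ (pKer (A†))ᗮ := by
  rintro _ ⟨u, rfl⟩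
  rw [mem_orthogonal]
  rintro _ ⟨w, hw, rfl⟩
  have h : ⟪A† w, (u : E)⟫ = ⟪(w : F), A u⟫ := adjoint_isFormalAdjoint hA w u
  have hw' : A† w = 0 := hw
  rw [hw', inner_zero_left] at h
  exact h.symm

/-- Functional a posteriori error estimate, upper bound for the `R(A₁)` part
of the error: with `e = x - xt` and `e_{A₁} = π_{R(A₁)} e`,
`‖e_{A₁}‖ = min_{ζ ∈ D(A₁†)} ( c₁‖A₁†ζ - g‖ + ‖ζ - xt‖ )`, the minimum being attained at
`ζ̂ = e_{A₁} + xt ∈ D(A₁†)`, which satisfies `A₁† ζ̂ = g`. -/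
theorem statement11 (A₁ : H₁ →ₗ.[ℝ] H₂) (A₂ : H₂ →ₗ.[ℝ] H₃)
    (hdense₁ : Dense (A₁.domain : Set H₁)) (hdense₂ : Dense (A₂.domain : Set H₂))
    (hclosed₁ : A₁.IsClosed) (hclosed₂ : A₂.IsClosed)
    (hcomplex : pRan A₁ ≤ pKer A₂)
    (hrange₁ : IsClosed (pRan A₁ : Set H₂)) (hrange₂ : IsClosed (pRan A₂ : Set H₃))
    (f : H₃) (g : H₁) (k : H₂)
    (hf : f ∈ pRan A₂) (hg : g ∈ pRan (A₁†)) (hk : k ∈ pKer A₂ ⊓ pKer (A₁†))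
    -- `x ∈ D₂` is the exact solution: `A₂ x = f`, `A₁† x = g`, `π x = k`
    (x : H₂) (hx₂ : x ∈ A₂.domain) (hx₁ : x ∈ (A₁†).domain)
    (hxf : A₂ ⟨x, hx₂⟩ = f) (hxg : A₁† ⟨x, hx₁⟩ = g)
    (hxk : x - k ∈ (pKer A₂ ⊓ pKer (A₁†))ᗮ)
    -- `xt` is an arbitrary (possibly nonconforming) approximation
    (xt : H₂)
    -- `c₁` is the Friedrichs/Poincaré constant for `A₁` (and for `A₁†`)
    (c₁ : ℝ) (hc₁pos : 0 < c₁)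
    (hc₁ : ∀ v : A₁.domain, (v : H₁) ∈ (pKer A₁)ᗮ → ‖(v : H₁)‖ ≤ c₁ * ‖A₁ v‖)
    (hc₁adj : ∀ w : (A₁†).domain, (w : H₂) ∈ (pKer (A₁†))ᗮ → ‖(w : H₂)‖ ≤ c₁ * ‖A₁† w‖)
    -- `eA₁ = π_{R(A₁)} (x - xt)`
    (eA₁ : H₂) (heA₁ : eA₁ ∈ pRan A₁) (heA₁perp : (x - xt) - eA₁ ∈ (pRan A₁)ᗮ) :
    IsLeast {r : ℝ | ∃ ζ : (A₁†).domain, r = c₁ * ‖A₁† ζ - g‖ + ‖(ζ : H₂) - xt‖} ‖eA₁‖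
    ∧ ∃ hζ : eA₁ + xt ∈ (A₁†).domain,
        A₁† ⟨eA₁ + xt, hζ⟩ = g
        ∧ c₁ * ‖A₁† ⟨eA₁ + xt, hζ⟩ - g‖ + ‖(eA₁ + xt) - xt‖ = ‖eA₁‖ := by
  obtain ⟨hζ, hζg⟩ : ∃ hζ : eA₁ + xt ∈ (A₁†).domain, A₁† ⟨eA₁ + xt, hζ⟩ = g := by
    have h := adjoint_sub_of_mem_orthogonal_pRan hdense₁ hx₁ heA₁perp
    rw [hxg, show x - (x - xt - eA₁) = eA₁ + xt by abel] at h
    exact h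
  have hval : c₁ * ‖A₁† ⟨eA₁ + xt, hζ⟩ - g‖ + ‖(eA₁ + xt) - xt‖ = ‖eA₁‖ := by
    simp [hζg]
  refine ⟨⟨⟨⟨_, hζ⟩, hval.symm⟩, ?_⟩, hζ, hζg, hval⟩
  rintro _ ⟨ζ, rfl⟩
  have : CompleteSpace (pRan A₁) := hrange₁.completeSpace_coe
  set P := (pRan A₁).starProjection
  have he : P (x - xt) = eA₁ := eq_starProjection_of_mem_orthogonal heA₁ heA₁perp
  have hP : ‖P (x - ζ)‖ ≤ c₁ * ‖A₁† ζ - g‖ := by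
    have hex := adjoint_sub_of_mem_orthogonal_pRan hdense₁
      (sub_mem hx₁ ζ.2) (sub_starProjection_mem_orthogonal (K := pRan A₁) (x - (ζ : H₂)))
    rw [sub_sub_cancel] at hex
    obtain ⟨hw, hwg⟩ := hex
    have hsub : A₁† ⟨x - ζ, sub_mem hx₁ ζ.2⟩ = g - A₁† ζ := by
      rw [← hxg, ← LinearPMap.map_sub]
      rfl
    have h := hc₁adj ⟨_, hw⟩ (pRan_le_orthogonal_pKer_adjoint hdense₁
      (starProjection_apply_mem _ _))
    rwa [hwg, hsub, norm_sub_rev g] at h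
  calc ‖eA₁‖ = ‖P (x - ζ) + P (ζ - xt)‖ := by rw [← _root_.map_add, sub_add_sub_cancel, he]
    _ ≤ ‖P (x - ζ)‖ + ‖P (ζ - xt)‖ := norm_add_le _ _
    _ ≤ _ := add_le_add hP ((pRan A₁).norm_starProjection_apply_le _)
end
end
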